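/- arXiv:1803.02415 — 2 statements merged into one kernel-verified Lean document; each statement's English description precedes it below -/
import Mathlib

section
/- Let K₁, K₂ ≥ 1 be integers, (τ,μ) ∈ T_{K₁}, and (ς,ν) ∈ T_{K₂}. Suppose that for every c ∈ ℝ, the sum Σ ς_j τ_k (μ_k − ν_j) exp(−(ν_j² + μ_k²)/2), taken over all pairs (j,k) with 1 ≤ j ≤ K₂, 1 ≤ k ≤ K₁ and ν_j + μ_k = c, equals zero. Then K₁ = K₂, μ_j = ν_j for all j = 1,…,K₁, and τ_k ς_j = τ_j ς_k for all j, k = 1,…,K₁; consequently τ = ς and μ = ν. -/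
/-- The ordered mixture parameter space. -/
def orderedMixtureSpace (K : ℕ) : Set ((Fin K → ℝ) × (Fin K → ℝ)) :=
  {p | (∀ j, 0 < p.1 j) ∧ (∑ j, p.1 j) = 1 ∧ StrictMono p.2}

theorem linearIndependent_exp_mul :
    LinearIndependent ℝ (fun t x : ℝ => Real.exp (t * x)) := by
  let φ : ℝ → (Multiplicative ℝ →* ℝ) := fun t =>
    { toFun := fun x => Real.exp (t * x.toAdd)
      map_one' := by simp
      map_mul' := fun x y => by simp [mul_add, Real.exp_add] }
  have hφ : Function.Injective φ := fun s t h => by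
    simpa [φ] using DFunLike.congr_fun h (Multiplicative.ofAdd 1)
  exact (linearIndependent_monoidHom (Multiplicative ℝ) ℝ).comp φ hφ

/-- An exponential sum vanishes if the coefficients of each exponent add up to zero. -/
theorem sum_mul_exp_eq_zero {ι : Type*} [Fintype ι] (w e : ι → ℝ)
    (h : ∀ c, ∑ i, (if e i = c then w i else 0) = 0) (x : ℝ) :
    ∑ i, w i * Real.exp (e i * x) = 0 := by
  classical
  rw [← Finset.sum_fiberwise_of_maps_to (t := Finset.univ.image e) (g := e) (by simp)]
  refine Finset.sum_eq_zero fun c _ => ?_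
  have hc := h c
  rw [← Finset.sum_filter] at hc
  calc _ = ∑ i ∈ Finset.univ.filter (fun i => e i = c), w i * Real.exp (c * x) :=
        Finset.sum_congr rfl fun i hi => by rw [(Finset.mem_filter.mp hi).2]
    _ = 0 := by rw [← Finset.sum_mul, hc, zero_mul]

theorem hasDerivAt_sum_mul_exp {ι : Type*} [Fintype ι] (a m : ι → ℝ) (x : ℝ) :
    HasDerivAt (fun x => ∑ i, a i * Real.exp (m i * x))
      (∑ i, a i * (Real.exp (m i * x) * m i)) x :=
  HasDerivAt.fun_sum fun i _ =>
    (by simpa using ((hasDerivAt_id x).const_mul (m i)).exp.const_mul (a i))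

/-- Two exponential sums with positive coefficients and vanishing Wronskian are proportional. -/
theorem exists_sum_mul_exp_eq_const_mul {ι κ : Type*} [Fintype ι] [Fintype κ] [Nonempty κ]
    (a m : ι → ℝ) (b n : κ → ℝ) (hb : ∀ j, 0 < b j)
    (h : ∀ x, ∑ j, ∑ i, b j * a i * (m i - n j) * Real.exp ((n j + m i) * x) = 0) :
    ∃ C : ℝ, ∀ x, ∑ i, a i * Real.exp (m i * x) = C * ∑ j, b j * Real.exp (n j * x) := by
  set f : ℝ → ℝ := fun x => ∑ i, a i * Real.exp (m i * x)
  set g : ℝ → ℝ := fun x => ∑ j, b j * Real.exp (n j * x)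
  have hg : ∀ x, g x ≠ 0 := fun x =>
    (Finset.sum_pos (fun j _ => mul_pos (hb j) (Real.exp_pos _)) Finset.univ_nonempty).ne'
  have hd : ∀ x, HasDerivAt (fun x => f x / g x) 0 x := fun x => by
    have hquot := (hasDerivAt_sum_mul_exp a m x).fun_div (hasDerivAt_sum_mul_exp b n x) (hg x)
    refine hquot.congr_deriv (div_eq_zero_iff.mpr (Or.inl ?_))
    rw [← h x, mul_comm, mul_comm (∑ i, a i * Real.exp (m i * x)), Finset.sum_mul_sum,
      Finset.sum_mul_sum, ← Finset.sum_sub_distrib]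
    refine Finset.sum_congr rfl fun j _ => ?_
    rw [← Finset.sum_sub_distrib]
    refine Finset.sum_congr rfl fun i _ => ?_
    rw [add_mul, Real.exp_add]
    ring
  refine ⟨f 0 / g 0, fun x => ?_⟩
  have hc := is_const_of_deriv_eq_zero (fun x => (hd x).differentiableAt)
    (fun x => (hd x).deriv) x 0
  exact (div_eq_iff (hg x)).mp hc

/-- Equal exponential sums have the same coefficient at each exponent. -/
theorem sum_single_eq_of_sum_mul_exp_eq {ι κ : Type*} [Fintype ι] [Fintype κ]
    (a m : ι → ℝ) (b n : κ → ℝ)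
    (h : ∀ x, ∑ i, a i * Real.exp (m i * x) = ∑ j, b j * Real.exp (n j * x)) :
    ∑ i, Finsupp.single (m i) (a i) = ∑ j, Finsupp.single (n j) (b j) := by
  apply linearIndependent_exp_mul
  ext x
  simpa [map_sum] using h x

theorem sum_single_apply_of_injective {ι : Type*} [Fintype ι] {m : ι → ℝ}
    (hm : Function.Injective m) (a : ι → ℝ) (i : ι) :
    (∑ i, Finsupp.single (m i) (a i)) (m i) = a i := by
  classical
  simp [Finsupp.finsetSum_apply, Finsupp.single_apply, hm.eq_iff]

theorem range_subset_of_sum_single_eq {ι κ : Type*} [Fintype ι] [Fintype κ]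
    {m : ι → ℝ} (hm : Function.Injective m) {a : ι → ℝ} (ha : ∀ i, a i ≠ 0)
    {b n : κ → ℝ}
    (h : ∑ i, Finsupp.single (m i) (a i) = ∑ j, Finsupp.single (n j) (b j)) :
    Set.range m ⊆ Set.range n := by
  classical
  rintro _ ⟨i, rfl⟩
  by_contra hi
  apply ha i
  rw [← sum_single_apply_of_injective hm a i, h, Finsupp.finsetSum_apply]
  exact Finset.sum_eq_zero fun j _ => Finsupp.single_eq_of_ne fun hj => hi ⟨j, hj.symm⟩

/-- the Claim in the proof of Theorem 1: if for every `c ∈ ℝ` the sum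
of `ς_j τ_k (μ_k − ν_j) exp(−(ν_j² + μ_k²)/2)` over all pairs `(j,k)` with
`ν_j + μ_k = c` vanishes, then the two ordered mixture parameters coincide. -/
theorem mixture_claim_induction (K₁ K₂ : ℕ) (hK₁ : 1 ≤ K₁) (hK₂ : 1 ≤ K₂)
    (τ μ : Fin K₁ → ℝ) (hτμ : (τ, μ) ∈ orderedMixtureSpace K₁)
    (ς ν : Fin K₂ → ℝ) (hςν : (ς, ν) ∈ orderedMixtureSpace K₂)
    (hsum : ∀ c : ℝ, ∑ j : Fin K₂, ∑ k : Fin K₁,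
      (if ν j + μ k = c then
        ς j * τ k * (μ k - ν j) * Real.exp (-(ν j ^ 2 + μ k ^ 2) / 2) else 0) = 0) :
    ∃ h : K₁ = K₂,
      (∀ j : Fin K₁, μ j = ν (Fin.cast h j)) ∧
      (∀ j k : Fin K₁, τ k * ς (Fin.cast h j) = τ j * ς (Fin.cast h k)) ∧
      (∀ j : Fin K₁, τ j = ς (Fin.cast h j)) := by
  obtain ⟨hτ, hτ_sum, hμ⟩ := hτμ
  obtain ⟨hς, hς_sum, hν⟩ := hςν
  dsimp only at hτ hτ_sum hμ hς hς_sum hν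
  have : Nonempty (Fin K₁) := ⟨⟨0, hK₁⟩⟩
  have : Nonempty (Fin K₂) := ⟨⟨0, hK₂⟩⟩
  set a : Fin K₁ → ℝ := fun k => τ k * Real.exp (-(μ k ^ 2) / 2)
  set b : Fin K₂ → ℝ := fun j => ς j * Real.exp (-(ν j ^ 2) / 2)
  have ha : ∀ k, 0 < a k := fun k => mul_pos (hτ k) (Real.exp_pos _)
  have hb : ∀ j, 0 < b j := fun j => mul_pos (hς j) (Real.exp_pos _)
  have hw : ∀ j k, ς j * τ k * (μ k - ν j) * Real.exp (-(ν j ^ 2 + μ k ^ 2) / 2) =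
      b j * a k * (μ k - ν j) := fun j k => by
    rw [show -(ν j ^ 2 + μ k ^ 2) / 2 = -(ν j ^ 2) / 2 + -(μ k ^ 2) / 2 by ring, Real.exp_add]
    ring
  obtain ⟨C, hC⟩ := exists_sum_mul_exp_eq_const_mul a μ b ν hb fun x => by
    rw [← Fintype.sum_prod_type']
    refine sum_mul_exp_eq_zero (fun p : Fin K₂ × Fin K₁ => b p.1 * a p.2 * (μ p.2 - ν p.1))
      (fun p => ν p.1 + μ p.2) (fun c => ?_) x
    simpa only [Fintype.sum_prod_type, hw] using hsum c
  have hC0 : C ≠ 0 := by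
    rintro rfl
    have hpos := Finset.sum_pos (fun k _ => mul_pos (ha k) (Real.exp_pos (μ k * 0)))
      Finset.univ_nonempty
    rw [hC 0, zero_mul] at hpos
    exact hpos.false
  have hcoeff : ∑ k, Finsupp.single (μ k) (a k) = ∑ j, Finsupp.single (ν j) (C * b j) :=
    sum_single_eq_of_sum_mul_exp_eq a μ (fun j => C * b j) ν fun x => by
      rw [hC x, Finset.mul_sum]
      simp only [mul_assoc]
  have hrange : Set.range μ = Set.range ν :=
    (range_subset_of_sum_single_eq hμ.injective (fun k => (ha k).ne') hcoeff).antisymm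
      (range_subset_of_sum_single_eq hν.injective (fun j => mul_ne_zero hC0 (hb j).ne')
        hcoeff.symm)
  obtain rfl : K₁ = K₂ := by
    simpa [Set.ncard_range_of_injective, hμ.injective, hν.injective, Nat.card_eq_fintype_card]
      using congrArg Set.ncard hrange
  obtain rfl : μ = ν := (StrictMono.range_inj hμ hν).mp hrange
  have hτC : ∀ k, τ k = C * ς k := fun k => by
    have hk := DFunLike.congr_fun hcoeff (μ k)
    rw [sum_single_apply_of_injective hμ.injective a k,
      sum_single_apply_of_injective hμ.injective (fun j => C * b j) k] at hk
    refine mul_right_cancel₀ (Real.exp_pos (-(μ k ^ 2) / 2)).ne' ?_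
    rw [mul_assoc]
    exact hk
  have hC1 : C = 1 := by
    simpa [hτC, ← Finset.mul_sum, hς_sum] using hτ_sum
  have hτς : ∀ k, τ k = ς k := fun k => by rw [hτC, hC1, one_mul]
  exact ⟨rfl, fun _ => rfl, fun j k => by simp [hτς, mul_comm], hτς⟩
end

section
/- Let f : ℝ → ℝ and c : ℝ → ℝ be continuous with c(y) > 0 for all y ∈ ℝ, let γ ∈ ℝ, and define Q(t,z) = ∫₀ᵗ Φ(f(y) + c(y)z) dy − tγ for t, z ∈ ℝ, where Φ is the standard normal cumulative distribution function. Let ζ be a real-valued random variable whose distribution is absolutely continuous with respect to Lebesgue measure. Then, almost surely, the function t ↦ Q(t,ζ) has at most one global minimizer over ℝ. -/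
open MeasureTheory

/-- The standard normal density `φ(x) = (2π)^{-1/2} exp(-x²/2)`. -/
noncomputable def stdNormalPdf (x : ℝ) : ℝ :=
  (Real.sqrt (2 * Real.pi))⁻¹ * Real.exp (-(x ^ 2) / 2)

/-- The standard normal cumulative distribution function. -/
noncomputable def stdNormalCdf (x : ℝ) : ℝ := ∫ u in Set.Iic x, stdNormalPdf u

/-- The limiting threshold-regression objective
`Q(t,z) = ∫₀ᵗ Φ(f(y) + c(y)z) dy − tγ`. -/
noncomputable def thresholdObjective (f c : ℝ → ℝ) (γ t z : ℝ) : ℝ :=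
  (∫ y in (0:ℝ)..t, stdNormalCdf (f y + c y * z)) - t * γ

theorem continuous_stdNormalPdf : Continuous stdNormalPdf := by
  unfold stdNormalPdf
  fun_prop

theorem stdNormalPdf_pos (x : ℝ) : 0 < stdNormalPdf x := by
  unfold stdNormalPdf
  positivity

theorem integrable_stdNormalPdf : Integrable stdNormalPdf := by
  have h := (integrable_exp_neg_mul_sq (b := 1 / 2) (by norm_num)).const_mul
    (Real.sqrt (2 * Real.pi))⁻¹
  refine h.congr (Filter.Eventually.of_forall fun x => ?_)
  simp only [stdNormalPdf]
  ring_nf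

theorem stdNormalCdf_sub (a b : ℝ) :
    stdNormalCdf b - stdNormalCdf a = ∫ u in a..b, stdNormalPdf u :=
  intervalIntegral.integral_Iic_sub_Iic integrable_stdNormalPdf.integrableOn
    integrable_stdNormalPdf.integrableOn

theorem continuous_stdNormalCdf : Continuous stdNormalCdf := by
  have h : stdNormalCdf = fun x => (∫ u in (0 : ℝ)..x, stdNormalPdf u) + stdNormalCdf 0 := by
    funext x
    rw [← stdNormalCdf_sub, sub_add_cancel]
  rw [h]
  exact (intervalIntegral.continuous_primitive
    (fun _ _ => continuous_stdNormalPdf.intervalIntegrable _ _) 0).add_const _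

theorem strictMono_stdNormalCdf : StrictMono stdNormalCdf := by
  intro a b hab
  rw [← sub_pos, stdNormalCdf_sub]
  exact intervalIntegral.intervalIntegral_pos_of_pos
    (continuous_stdNormalPdf.intervalIntegrable _ _) stdNormalPdf_pos hab

theorem thresholdObjective_sub_lt_sub {f c : ℝ → ℝ} (hf : Continuous f) (hc : Continuous c)
    (hcpos : ∀ y : ℝ, 0 < c y) (γ : ℝ) {s t z w : ℝ} (hst : s < t) (hzw : z < w) :
    thresholdObjective f c γ t z - thresholdObjective f c γ s z <
      thresholdObjective f c γ t w - thresholdObjective f c γ s w := by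
  have hcont (x : ℝ) : Continuous fun y => stdNormalCdf (f y + c y * x) :=
    continuous_stdNormalCdf.comp (hf.add (hc.mul_const x))
  have hint (x a b : ℝ) :
      IntervalIntegrable (fun y => stdNormalCdf (f y + c y * x)) volume a b :=
    (hcont x).intervalIntegrable a b
  have hpos : 0 < ∫ y in s..t,
      (stdNormalCdf (f y + c y * w) - stdNormalCdf (f y + c y * z)) := by
    refine intervalIntegral.intervalIntegral_pos_of_pos ((hint w s t).sub (hint z s t))
      (fun y => sub_pos.2 (strictMono_stdNormalCdf ?_)) hst
    have := mul_lt_mul_of_pos_left hzw (hcpos y)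
    linarith
  rw [intervalIntegral.integral_sub (hint w s t) (hint z s t)] at hpos
  have hz := intervalIntegral.integral_interval_sub_left (hint z 0 t) (hint z 0 s)
  have hw := intervalIntegral.integral_interval_sub_left (hint w 0 t) (hint w 0 s)
  simp only [thresholdObjective]
  linarith

/-- If the increments `g t z - g s z` are strictly increasing in the parameter `z`, then the
minimizers of `g · z` decrease with `z`, so only countably many `z` admit several of them. -/
theorem countable_setOf_exists_lt_minimizers {g : ℝ → ℝ → ℝ}
    (hg : ∀ ⦃s t z w : ℝ⦄, s < t → z < w → g t z - g s z < g t w - g s w) :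
    {z | ∃ t₁ t₂ : ℝ, t₁ < t₂ ∧ (∀ t, g t₁ z ≤ g t z) ∧ ∀ t, g t₂ z ≤ g t z}.Countable := by
  set S := {z | ∃ t₁ t₂ : ℝ, t₁ < t₂ ∧ (∀ t, g t₁ z ≤ g t z) ∧ ∀ t, g t₂ z ≤ g t z}
  have hq : ∀ z : S, ∃ q : ℚ, ∃ t₁ t₂ : ℝ, t₁ < q ∧ q < t₂ ∧
      (∀ t, g t₁ z ≤ g t z) ∧ ∀ t, g t₂ z ≤ g t z := by
    rintro ⟨z, t₁, t₂, hlt, h₁, h₂⟩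
    obtain ⟨q, hq₁, hq₂⟩ := exists_rat_btwn hlt
    exact ⟨q, t₁, t₂, hq₁, hq₂, h₁, h₂⟩
  choose q t₁ t₂ h₁ h₂ hmin₁ hmin₂ using hq
  have hanti : StrictAnti q := by
    intro z w hzw
    have hle : t₂ w ≤ t₁ z := by
      by_contra! hlt
      have := hg hlt (Subtype.coe_lt_coe.2 hzw)
      linarith [hmin₁ z (t₂ w), hmin₂ w (t₁ z)]
    exact_mod_cast (h₂ w).trans_le (hle.trans (h₁ z).le)
  exact Set.countable_coe_iff.1 hanti.injective.countable

/-- uniqueness in the proof of Theorem 3: driven by an absolutely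
continuous scalar random variable with distribution `P`, the threshold objective has,
almost surely, at most one global minimizer over `ℝ`. -/
theorem threshold_objective_unique_argmin (f c : ℝ → ℝ)
    (hf : Continuous f) (hc : Continuous c) (hcpos : ∀ y : ℝ, 0 < c y) (γ : ℝ)
    (P : Measure ℝ) [IsProbabilityMeasure P] (hP : P ≪ volume) :
    ∀ᵐ z ∂P, ∀ t₁ t₂ : ℝ,
      (∀ t : ℝ, thresholdObjective f c γ t₁ z ≤ thresholdObjective f c γ t z) →
      (∀ t : ℝ, thresholdObjective f c γ t₂ z ≤ thresholdObjective f c γ t z) →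
      t₁ = t₂ := by
  have hnull := (countable_setOf_exists_lt_minimizers
    (g := thresholdObjective f c γ)
    fun _ _ _ _ => thresholdObjective_sub_lt_sub hf hc hcpos γ).measure_zero volume
  filter_upwards [measure_eq_zero_iff_ae_notMem.1 (hP hnull)] with z hz t₁ t₂ h₁ h₂
  rcases lt_trichotomy t₁ t₂ with h | h | h
  · exact (hz ⟨t₁, t₂, h, h₁, h₂⟩).elim
  · exact h
  · exact (hz ⟨t₂, t₁, h, h₂, h₁⟩).elim
end
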